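/- Let p ∈ [1,∞), let U be uniformly distributed on [0,1], and let n ≥ 2. For any grid 0 = x_1 < x_2 < … < x_n = 1 one has d^p_p(U;{x_1,…,x_n}) = (2/((p+1)(p+2))) · Σ_{i=1}^{n−1} (x_{i+1} − x_i)^{p+1}. Consequently, among all such grids of size n containing the endpoints 0 and 1, the equidistant grid x*_i = (i−1)/(n−1), i = 1,…,n, is optimal, and the optimal value is d^p_n(U) = (2/((p+1)(p+2))) · (n−1)^{−p}. -/

import Mathlib

open MeasureTheory Set
open scoped ENNReal

/-- `p`-th power of the local dual quantization error `F_p(ξ; Γ)^p` for the grid given by the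
tuple `x = (x_1, …, x_n)`, with the convention `inf ∅ = +∞`. -/
noncomputable def dualQuantFp (p : ℝ) {n : ℕ} (x : Fin n → ℝ) (ξ : ℝ) : ℝ≥0∞ :=
  ⨅ l : {l : Fin n → ℝ // (∀ i, 0 ≤ l i) ∧ ∑ i, l i = 1 ∧ ∑ i, l i • x i = ξ},
    ENNReal.ofReal (∑ i, l.1 i * |ξ - x i| ^ p)

/-- The cost of splitting `ξ ∈ [a, b]` between the two endpoints of the interval. -/
noncomputable def intervalCost (p a b ξ : ℝ) : ℝ :=
  ((b - ξ) * (ξ - a) ^ p + (ξ - a) * (b - ξ) ^ p) / (b - a)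

theorem convexOn_abs_sub_rpow {p : ℝ} (hp : 1 ≤ p) (ξ : ℝ) :
    ConvexOn ℝ univ fun y : ℝ => |ξ - y| ^ p := by
  refine ⟨convex_univ, fun u _ v _ s t hs ht hst => ?_⟩
  have habs : |ξ - (s • u + t • v)| ≤ s • |ξ - u| + t • |ξ - v| := by
    have : ξ - (s • u + t • v) = s * (ξ - u) + t * (ξ - v) := by
      simp only [smul_eq_mul]
      linear_combination (-ξ) * hst
    rw [this]
    refine (abs_add_le _ _).trans_eq ?_
    rw [abs_mul, abs_mul, abs_of_nonneg hs, abs_of_nonneg ht, smul_eq_mul, smul_eq_mul]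
  exact (Real.rpow_le_rpow (abs_nonneg _) habs (by linarith)).trans
    ((convexOn_rpow hp).2 (mem_Ici.2 (abs_nonneg _)) (mem_Ici.2 (abs_nonneg _)) hs ht hst)

/-- Outside `(a, b)` a convex function lies above its chord over `[a, b]`. -/
theorem ConvexOn.chord_le_of_notMem_Ioo {g : ℝ → ℝ} (hg : ConvexOn ℝ univ g) {a b y : ℝ}
    (hab : a < b) (hy : y ≤ a ∨ b ≤ y) :
    ((b - y) * g a + (y - a) * g b) / (b - a) ≤ g y := by
  rw [div_le_iff₀ (sub_pos.2 hab)]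
  rcases hy with hy | hy
  · have hyb : 0 < b - y := by linarith
    have h := hg.2 (mem_univ y) (mem_univ b)
      (div_nonneg (by linarith) hyb.le : 0 ≤ (b - a) / (b - y))
      (div_nonneg (by linarith) hyb.le : 0 ≤ (a - y) / (b - y))
      (by field_simp; ring)
    have hpt : ((b - a) / (b - y)) • y + ((a - y) / (b - y)) • b = a := by
      simp only [smul_eq_mul]; field_simp; ring
    rw [hpt, smul_eq_mul, smul_eq_mul, div_mul_eq_mul_div, div_mul_eq_mul_div, ← add_div,
      le_div_iff₀ hyb] at h
    linarith
  · have hya : 0 < y - a := by linarith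
    have h := hg.2 (mem_univ a) (mem_univ y)
      (div_nonneg (by linarith) hya.le : 0 ≤ (y - b) / (y - a))
      (div_nonneg (by linarith) hya.le : 0 ≤ (b - a) / (y - a))
      (by field_simp; ring)
    have hpt : ((y - b) / (y - a)) • a + ((b - a) / (y - a)) • y = b := by
      simp only [smul_eq_mul]; field_simp; ring
    rw [hpt, smul_eq_mul, smul_eq_mul, div_mul_eq_mul_div, div_mul_eq_mul_div, ← add_div,
      le_div_iff₀ hya] at h
    linarith

theorem dualQuantFp_eq_intervalCost {p : ℝ} (hp : 1 ≤ p) {n : ℕ} {x : Fin (n + 1) → ℝ}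
    (hx : StrictMono x) (i : Fin n) {ξ : ℝ} (hξ : ξ ∈ Icc (x i.castSucc) (x i.succ)) :
    dualQuantFp p x ξ = ENNReal.ofReal (intervalCost p (x i.castSucc) (x i.succ) ξ) := by
  have hab : x i.castSucc < x i.succ := hx Fin.castSucc_lt_succ
  have hne : x i.succ - x i.castSucc ≠ 0 := (sub_pos.2 hab).ne'
  have ha : |ξ - x i.castSucc| = ξ - x i.castSucc := abs_of_nonneg (sub_nonneg.2 hξ.1)
  have hb : |ξ - x i.succ| = x i.succ - ξ := by
    rw [abs_sub_comm]; exact abs_of_nonneg (sub_nonneg.2 hξ.2)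
  apply le_antisymm
  · let l : Fin (n + 1) → ℝ :=
      Pi.single i.castSucc ((x i.succ - ξ) / (x i.succ - x i.castSucc)) +
        Pi.single i.succ ((ξ - x i.castSucc) / (x i.succ - x i.castSucc))
    have hsum (f : Fin (n + 1) → ℝ) : ∑ j, l j * f j =
        (x i.succ - ξ) / (x i.succ - x i.castSucc) * f i.castSucc +
          (ξ - x i.castSucc) / (x i.succ - x i.castSucc) * f i.succ := by
      simp [l, add_mul, Finset.sum_add_distrib, Pi.single_apply, ite_mul]
    have hl : (∀ j, 0 ≤ l j) ∧ ∑ j, l j = 1 ∧ ∑ j, l j • x j = ξ := by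
      refine ⟨fun j => ?_, ?_, ?_⟩
      · refine add_nonneg ?_ ?_
        · exact (Pi.single_nonneg.2
            (div_nonneg (sub_nonneg.2 hξ.2) (sub_pos.2 hab).le) : (0 : Fin (n + 1) → ℝ) ≤ _) j
        · exact (Pi.single_nonneg.2
            (div_nonneg (sub_nonneg.2 hξ.1) (sub_pos.2 hab).le) : (0 : Fin (n + 1) → ℝ) ≤ _) j
      · have h := hsum fun _ => 1
        simp only [mul_one] at h
        rw [h]; field_simp; ring
      · simp only [smul_eq_mul]
        rw [hsum]; field_simp; ring
    refine (iInf_le _ ⟨l, hl⟩).trans_eq ?_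
    congr 1
    rw [hsum fun j => |ξ - x j| ^ p, ha, hb, intervalCost]
    ring
  · refine le_iInf fun ⟨l, hl0, hl1, hlξ⟩ => ENNReal.ofReal_le_ofReal ?_
    have hchord (j : Fin (n + 1)) :
        ((x i.succ - x j) * (ξ - x i.castSucc) ^ p + (x j - x i.castSucc) * (x i.succ - ξ) ^ p) /
          (x i.succ - x i.castSucc) ≤ |ξ - x j| ^ p := by
      have h := (convexOn_abs_sub_rpow hp ξ).chord_le_of_notMem_Ioo hab (y := x j) (by
        rcases le_or_gt j i.castSucc with hj | hj
        · exact .inl (hx.monotone hj)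
        · exact .inr (hx.monotone (Fin.castSucc_lt_iff_succ_le.1 hj)))
      simpa only [ha, hb] using h
    refine le_trans (le_of_eq ?_)
      (Finset.sum_le_sum fun j _ => mul_le_mul_of_nonneg_left (hchord j) (hl0 j))
    set A := (ξ - x i.castSucc) ^ p
    set B := (x i.succ - ξ) ^ p
    have hterm (j : Fin (n + 1)) :
        l j * (((x i.succ - x j) * A + (x j - x i.castSucc) * B) / (x i.succ - x i.castSucc)) =
          l j * ((x i.succ * A - x i.castSucc * B) / (x i.succ - x i.castSucc)) +
            l j * x j * ((B - A) / (x i.succ - x i.castSucc)) := by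
      ring
    simp only [smul_eq_mul] at hlξ
    rw [Finset.sum_congr rfl fun j _ => hterm j, Finset.sum_add_distrib, ← Finset.sum_mul,
      ← Finset.sum_mul, hl1, hlξ, intervalCost]
    ring

theorem lintegral_Ioc_eq_sum (f : ℝ → ℝ≥0∞) {n : ℕ} {x : Fin (n + 1) → ℝ} (hx : Monotone x) :
    ∫⁻ ξ in Ioc (x 0) (x (Fin.last n)), f ξ =
      ∑ i : Fin n, ∫⁻ ξ in Ioc (x i.castSucc) (x i.succ), f ξ := by
  induction n with
  | zero => simp
  | succ n ih =>
    have h := ih (x := x ∘ Fin.castSucc) (hx.comp Fin.strictMono_castSucc.monotone)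
    simp only [Function.comp_apply, Fin.castSucc_zero] at h
    rw [Fin.sum_univ_castSucc]
    simp only [Fin.succ_castSucc, Fin.succ_last]
    rw [← h, ← Ioc_union_Ioc_eq_Ioc (hx (Fin.zero_le (Fin.last n).castSucc))
      (hx (Fin.le_last (Fin.last n).castSucc)),
      lintegral_union measurableSet_Ioc (Ioc_disjoint_Ioc_of_le le_rfl)]

theorem integral_sub_mul_rpow {p h : ℝ} (hp : 0 ≤ p) (hh : 0 ≤ h) :
    ∫ t in (0 : ℝ)..h, (h - t) * t ^ p = h ^ (p + 2) / ((p + 1) * (p + 2)) := by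
  have hcongr : ∫ t in (0 : ℝ)..h, (h - t) * t ^ p =
      ∫ t in (0 : ℝ)..h, (h * t ^ p - t ^ (p + 1)) := by
    refine intervalIntegral.integral_congr fun t ht => ?_
    rw [uIcc_of_le hh] at ht
    rw [Real.rpow_add_one' ht.1 (by linarith)]
    ring
  have h1 : (p + 1 : ℝ) ≠ 0 := by linarith
  have h2 : (p + 2 : ℝ) ≠ 0 := by linarith
  rw [hcongr, intervalIntegral.integral_sub
    ((intervalIntegral.intervalIntegrable_rpow' (by linarith)).const_mul h)
    (intervalIntegral.intervalIntegrable_rpow' (by linarith)),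
    intervalIntegral.integral_const_mul, integral_rpow (.inl (by linarith)),
    integral_rpow (.inl (by linarith)), show p + 1 + 1 = p + 2 by ring,
    Real.zero_rpow h1, Real.zero_rpow h2, show p + 2 = p + 1 + 1 by ring,
    Real.rpow_add_one' hh (y := p + 1) (by linarith)]
  have h3 : (p + 1 + 1 : ℝ) ≠ 0 := by linarith
  field_simp
  ring

theorem continuous_intervalCost {p : ℝ} (hp : 0 ≤ p) (a b : ℝ) :
    Continuous (intervalCost p a b) := by
  unfold intervalCost
  have h1 : Continuous fun ξ : ℝ => (ξ - a) ^ p :=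
    (continuous_id.sub continuous_const).rpow_const fun _ => .inr hp
  have h2 : Continuous fun ξ : ℝ => (b - ξ) ^ p :=
    (continuous_const.sub continuous_id).rpow_const fun _ => .inr hp
  fun_prop

theorem integral_intervalCost {p a b : ℝ} (hp : 0 ≤ p) (hab : a < b) :
    ∫ ξ in a..b, intervalCost p a b ξ = 2 / ((p + 1) * (p + 2)) * (b - a) ^ (p + 1) := by
  have hba : 0 < b - a := sub_pos.2 hab
  have h1 : Continuous fun ξ : ℝ => (b - ξ) * (ξ - a) ^ p :=
    (continuous_const.sub continuous_id).mul
      ((continuous_id.sub continuous_const).rpow_const fun _ => .inr hp)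
  have h2 : Continuous fun ξ : ℝ => (ξ - a) * (b - ξ) ^ p :=
    (continuous_id.sub continuous_const).mul
      ((continuous_const.sub continuous_id).rpow_const fun _ => .inr hp)
  have e1 : ∫ ξ in a..b, (b - ξ) * (ξ - a) ^ p =
      (b - a) ^ (p + 2) / ((p + 1) * (p + 2)) := by
    have h := intervalIntegral.integral_comp_sub_right (a := a) (b := b)
      (fun t : ℝ => (b - a - t) * t ^ p) a
    rw [sub_self, integral_sub_mul_rpow hp hba.le] at h
    rw [← h]
    congr 1 with ξ
    ring
  have e2 : ∫ ξ in a..b, (ξ - a) * (b - ξ) ^ p =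
      (b - a) ^ (p + 2) / ((p + 1) * (p + 2)) := by
    have h := intervalIntegral.integral_comp_sub_left (a := a) (b := b)
      (fun t : ℝ => (b - a - t) * t ^ p) b
    rw [sub_self, integral_sub_mul_rpow hp hba.le] at h
    rw [← h]
    congr 1 with ξ
    ring
  simp only [intervalCost]
  rw [intervalIntegral.integral_div, intervalIntegral.integral_add
    (h1.intervalIntegrable _ _) (h2.intervalIntegrable _ _), e1, e2,
    show p + 2 = p + 1 + 1 by ring, Real.rpow_add_one hba.ne']
  field_simp
  ring

theorem intervalCost_nonneg {p a b ξ : ℝ} (hξ : ξ ∈ Icc a b) : 0 ≤ intervalCost p a b ξ := by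
  have h1 := sub_nonneg.2 hξ.1
  have h2 := sub_nonneg.2 hξ.2
  exact div_nonneg (by positivity) (sub_nonneg.2 (hξ.1.trans hξ.2))

theorem lintegral_intervalCost {p a b : ℝ} (hp : 0 ≤ p) (hab : a < b) :
    ∫⁻ ξ in Ioc a b, ENNReal.ofReal (intervalCost p a b ξ) =
      ENNReal.ofReal (2 / ((p + 1) * (p + 2)) * (b - a) ^ (p + 1)) := by
  rw [← integral_intervalCost hp hab, intervalIntegral.integral_of_le hab.le,
    ofReal_integral_eq_lintegral_ofReal]
  · exact (continuous_intervalCost hp a b).integrableOn_Ioc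
  · exact (ae_restrict_iff' measurableSet_Ioc).2
      (.of_forall fun ξ hξ => intervalCost_nonneg (Ioc_subset_Icc_self hξ))

theorem lintegral_dualQuantFp {p : ℝ} (hp : 1 ≤ p) {n : ℕ} {x : Fin (n + 1) → ℝ}
    (hx : StrictMono x) :
    ∫⁻ ξ in Icc (x 0) (x (Fin.last n)), dualQuantFp p x ξ =
      ENNReal.ofReal (2 / ((p + 1) * (p + 2)) *
        ∑ i : Fin n, (x i.succ - x i.castSucc) ^ (p + 1)) := by
  have hlt (i : Fin n) : x i.castSucc < x i.succ := hx Fin.castSucc_lt_succ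
  rw [setLIntegral_congr Ioc_ae_eq_Icc.symm, lintegral_Ioc_eq_sum _ hx.monotone,
    Finset.mul_sum, ENNReal.ofReal_sum_of_nonneg]
  · refine Finset.sum_congr rfl fun i _ => ?_
    rw [← lintegral_intervalCost (by linarith) (hlt i)]
    exact setLIntegral_congr_fun measurableSet_Ioc fun ξ hξ =>
      dualQuantFp_eq_intervalCost hp hx i (Ioc_subset_Icc_self hξ)
  · intro i _
    have := sub_pos.2 (hlt i)
    positivity

theorem sum_succ_sub_castSucc {n : ℕ} (x : Fin (n + 1) → ℝ) :
    ∑ i : Fin n, (x i.succ - x i.castSucc) = x (Fin.last n) - x 0 := by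
  have h := Fin.sum_univ_succ x
  rw [Fin.sum_univ_castSucc] at h
  rw [Finset.sum_sub_distrib]
  linarith

theorem inv_rpow_le_sum_rpow {p : ℝ} (hp : 0 ≤ p) {n : ℕ} (hn : 1 ≤ n) {h : Fin n → ℝ}
    (h0 : ∀ i, 0 ≤ h i) (h1 : ∑ i, h i = 1) : ((n : ℝ) ^ p)⁻¹ ≤ ∑ i, h i ^ (p + 1) := by
  have hn0 : (0 : ℝ) < n := by exact_mod_cast hn
  have := Real.rpow_sum_le_const_mul_sum_rpow_of_nonneg Finset.univ (p := p + 1) (f := h)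
    (by linarith) fun i _ => h0 i
  rw [h1, Real.one_rpow, add_sub_cancel_right, Finset.card_univ, Fintype.card_fin] at this
  exact (inv_le_iff_one_le_mul₀' (Real.rpow_pos_of_pos hn0 p)).2 this

/-- Let `p ∈ [1,∞)`, `U` uniform on `[0,1]` and `n ≥ 1` (grids of `n+1`
points `0 = x_1 < … < x_{n+1} = 1`). Then
`d^p_p(U;{x_1,…,x_{n+1}}) = (2/((p+1)(p+2))) Σ_i (x_{i+1}−x_i)^{p+1}`; the equidistant grid
`x*_i = (i−1)/n` attains the value `(2/((p+1)(p+2))) n^{−p}`, which is optimal among all such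
grids containing the endpoints. -/
theorem stmt19 (p : ℝ) (hp : 1 ≤ p) (n : ℕ) (hn : 1 ≤ n) :
    (∀ x : Fin (n + 1) → ℝ, StrictMono x → x 0 = 0 → x (Fin.last n) = 1 →
      (∫⁻ ξ, dualQuantFp p x ξ ∂(MeasureTheory.volume.restrict (Set.Icc (0 : ℝ) 1))) =
        ENNReal.ofReal (2 / ((p + 1) * (p + 2)) *
          ∑ i : Fin n, (x i.succ - x i.castSucc) ^ (p + 1))) ∧
    ((∫⁻ ξ, dualQuantFp p (fun i : Fin (n + 1) => (i : ℕ) / (n : ℝ)) ξ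
        ∂(MeasureTheory.volume.restrict (Set.Icc (0 : ℝ) 1))) =
      ENNReal.ofReal (2 / ((p + 1) * (p + 2)) / (n : ℝ) ^ p)) ∧
    (∀ x : Fin (n + 1) → ℝ, StrictMono x → x 0 = 0 → x (Fin.last n) = 1 →
      ENNReal.ofReal (2 / ((p + 1) * (p + 2)) / (n : ℝ) ^ p) ≤
        ∫⁻ ξ, dualQuantFp p x ξ ∂(MeasureTheory.volume.restrict (Set.Icc (0 : ℝ) 1))) := by
  have hn0 : (0 : ℝ) < n := by exact_mod_cast hn
  have value (x : Fin (n + 1) → ℝ) (hx : StrictMono x) (hx0 : x 0 = 0)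
      (hx1 : x (Fin.last n) = 1) := by
    have h := lintegral_dualQuantFp hp hx
    rw [hx0, hx1] at h
    exact h
  refine ⟨value, ?_, fun x hx hx0 hx1 => ?_⟩
  · rw [value]
    · congr 1
      have hterm (i : Fin n) :
          ((i.succ : ℕ) / (n : ℝ) - (i.castSucc : ℕ) / (n : ℝ)) = (n : ℝ)⁻¹ := by
        simp only [Fin.val_succ, Fin.val_castSucc]
        push_cast
        ring
      simp only [hterm, Finset.sum_const, Finset.card_univ, Fintype.card_fin, nsmul_eq_mul]
      rw [Real.inv_rpow hn0.le, Real.rpow_add_one hn0.ne']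
      field_simp
    · intro i j hij
      exact div_lt_div_of_pos_right (Nat.cast_lt.2 hij) hn0
    · simp
    · simp [hn0.ne']
  · rw [value x hx hx0 hx1]
    refine ENNReal.ofReal_le_ofReal ?_
    rw [div_eq_mul_inv _ ((n : ℝ) ^ p)]
    refine mul_le_mul_of_nonneg_left (inv_rpow_le_sum_rpow (by linarith) hn (fun i => ?_) ?_)
      (by positivity)
    · exact sub_nonneg.2 (hx.monotone Fin.castSucc_lt_succ.le)
    · rw [sum_succ_sub_castSucc, hx0, hx1, sub_zero]
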